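/- Let D be a discriminant form of exponent a power of an odd prime p, and γ ∈ D. If e^γ lies in the span of the images of the isotropic lifts ↑_H over all nontrivial isotropic subgroups H of D, then γ^⊥ contains at least two distinct isotropic subgroups of order p. -/

import Mathlib

open scoped Classical BigOperators

noncomputable section

/-- The bilinear form associated to a quadratic form `q : D → ℚ/ℤ`. -/
def bil {D : Type*} [AddCommGroup D] (q : D → AddCircle (1 : ℚ)) (x y : D) :
    AddCircle (1 : ℚ) :=
  q (x + y) - q x - q y

/-- The standard basis vector `e^γ` of `ℂ[D]`. -/
def eV {D : Type*} (γ : D) : D → ℂ := fun β => if β = γ then 1 else 0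

/-- `↑_H(e^{γ+H}) = ∑_{μ ∈ H} e^{γ+μ}`, as an element of `ℂ[D]`. -/
def liftVec {D : Type*} [AddCommGroup D] (H : AddSubgroup D) (γ : D) : D → ℂ :=
  fun β => if β - γ ∈ H then 1 else 0

/-- `im(↑) = ∑_H im(↑_H)`, the span of all isotropic lifts over nontrivial
isotropic subgroups `H` of `D`: `im(↑_H)` is spanned by the lifts
`↑_H(e^{γ+H}) = ∑_{μ∈H} e^{γ+μ}` of the basis vectors, `γ ∈ H^⊥`. -/
def imUp {D : Type*} [AddCommGroup D] (q : D → AddCircle (1 : ℚ)) :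
    Submodule ℂ (D → ℂ) :=
  Submodule.span ℂ
    {v | ∃ H : AddSubgroup D, H ≠ ⊥ ∧ (∀ x ∈ H, q x = 0) ∧
      ∃ γ : D, (∀ μ ∈ H, bil q γ μ = 0) ∧ v = liftVec H γ}

theorem exists_zsmul_inv_of_nsmul_eq_zero {p : ℕ} (hp : p ≠ 0) {u : AddCircle (1 : ℚ)}
    (hu : p • u = 0) : ∃ k : ℤ, u = k • (((p : ℚ)⁻¹ : ℚ) : AddCircle (1 : ℚ)) := by
  induction u using QuotientAddGroup.induction_on with
  | H r =>
    have h : ((p • r : ℚ) : AddCircle (1 : ℚ)) = 0 := hu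
    rw [AddCircle.coe_eq_zero_iff] at h
    obtain ⟨n, hn⟩ := h
    refine ⟨n, ?_⟩
    rw [← AddCircle.coe_zsmul]
    congr 1
    simp only [nsmul_eq_mul, zsmul_eq_mul, mul_one] at hn ⊢
    rw [hn]
    field_simp

theorem zsmul_inv_eq_zero_iff {p : ℕ} (hp : p ≠ 0) (k : ℤ) :
    k • (((p : ℚ)⁻¹ : ℚ) : AddCircle (1 : ℚ)) = 0 ↔ (p : ℤ) ∣ k := by
  have hp' : (p : ℚ) ≠ 0 := Nat.cast_ne_zero.mpr hp
  rw [← AddCircle.coe_zsmul, AddCircle.coe_eq_zero_iff]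
  refine exists_congr fun n => ?_
  simp only [zsmul_eq_mul, mul_one]
  rw [eq_mul_inv_iff_mul_eq₀ hp', mul_comm]
  constructor <;> intro h
  · exact_mod_cast h.symm
  · exact_mod_cast h.symm

theorem exists_ne_zero_nsmul_prime_eq_zero {D : Type*} [AddCommGroup D] {p : ℕ}
    (hexp : ∃ k : ℕ, ∀ x : D, p ^ k • x = 0) {H : AddSubgroup D} (hH : H ≠ ⊥) :
    ∃ ν ∈ H, ν ≠ 0 ∧ p • ν = 0 := by
  obtain ⟨x, hxH, hx⟩ := (AddSubgroup.bot_or_exists_ne_zero H).resolve_left hH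
  obtain ⟨k, hk⟩ := hexp
  replace hk := hk x
  induction k with
  | zero => exact absurd (by simpa using hk) hx
  | succ k ih =>
    by_cases h : p ^ k • x = 0
    · exact ih h
    · exact ⟨_, H.nsmul_mem hxH _, h, by rw [← mul_nsmul, ← pow_succ, hk]⟩

theorem bil_comm {D : Type*} [AddCommGroup D] (q : D → AddCircle (1 : ℚ)) (x y : D) :
    bil q x y = bil q y x := by
  unfold bil
  rw [add_comm x y]
  abel

section

variable {D : Type*} [AddCommGroup D] {q : D → AddCircle (1 : ℚ)}

theorem map_add_eq_add_bil (x y : D) : q (x + y) = q x + q y + bil q x y := by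
  unfold bil
  abel

theorem bil_add_right (hbil : ∀ x y z : D, bil q (x + y) z = bil q x z + bil q y z)
    (x y z : D) : bil q x (y + z) = bil q x y + bil q x z := by
  rw [bil_comm, hbil, bil_comm q y, bil_comm q z]

theorem bil_zsmul_left (hbil : ∀ x y z : D, bil q (x + y) z = bil q x z + bil q y z)
    (n : ℤ) (x y : D) : bil q (n • x) y = n • bil q x y :=
  map_zsmul (AddMonoidHom.mk' (fun x => bil q x y) fun a b => hbil a b y) n x

theorem bil_zsmul_right (hbil : ∀ x y z : D, bil q (x + y) z = bil q x z + bil q y z)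
    (n : ℤ) (x y : D) : bil q x (n • y) = n • bil q x y := by
  rw [bil_comm, bil_zsmul_left hbil, bil_comm]

theorem bil_eq_zsmul_inv (hbil : ∀ x y z : D, bil q (x + y) z = bil q x z + bil q y z)
    {p : ℕ} (hp : p ≠ 0) (x : D) {y : D} (hy : p • y = 0) :
    ∃ k : ℤ, bil q x y = k • (((p : ℚ)⁻¹ : ℚ) : AddCircle (1 : ℚ)) := by
  refine exists_zsmul_inv_of_nsmul_eq_zero hp ?_
  rw [← natCast_zsmul] at hy ⊢
  rw [← bil_zsmul_right hbil, hy]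
  simpa using bil_zsmul_right hbil 0 x 0

/-- If `γ ⊥ μ` but both `γ + μ` and `γ - μ` are orthogonal to isotropic `p`-torsion vectors
not orthogonal to `γ`, then `γ^⊥` contains an isotropic `p`-torsion vector not orthogonal
to `μ`. -/
theorem exists_isotropic_not_orthogonal
    (hbil : ∀ x y z : D, bil q (x + y) z = bil q x z + bil q y z)
    (hquad : ∀ (n : ℤ) (x : D), q (n • x) = (n ^ 2 : ℤ) • q x)
    {p : ℕ} (hp : p.Prime) (hodd : p ≠ 2) {γ μ ν₁ ν₂ : D}
    (hμ : p • μ = 0) (hν₁ : p • ν₁ = 0) (hν₂ : p • ν₂ = 0)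
    (qμ : q μ = 0) (qν₁ : q ν₁ = 0) (qν₂ : q ν₂ = 0) (hγμ : bil q γ μ = 0)
    (h₁ : bil q (γ + μ) ν₁ = 0) (h₂ : bil q (γ + -μ) ν₂ = 0)
    (hγ₁ : bil q γ ν₁ ≠ 0) (hγ₂ : bil q γ ν₂ ≠ 0) :
    ∃ x : D, p • x = 0 ∧ q x = 0 ∧ bil q γ x = 0 ∧ bil q μ x ≠ 0 := by
  obtain ⟨c₁, hc₁⟩ := bil_eq_zsmul_inv hbil hp.ne_zero μ hν₁
  obtain ⟨c₂, hc₂⟩ := bil_eq_zsmul_inv hbil hp.ne_zero μ hν₂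
  obtain ⟨m, hm⟩ := bil_eq_zsmul_inv hbil hp.ne_zero ν₁ hν₂
  have hz := zsmul_inv_eq_zero_iff hp.ne_zero
  set g : AddCircle (1 : ℚ) := (((p : ℚ)⁻¹ : ℚ) : AddCircle (1 : ℚ))
  have hμμ : bil q μ μ = 0 := by
    have h := hquad 2 μ
    rw [two_zsmul, map_add_eq_add_bil (q := q), qμ] at h
    simpa using h
  have hg₁ : bil q γ ν₁ = (-c₁) • g := by
    rw [hbil, hc₁] at h₁
    rw [neg_zsmul]
    exact eq_neg_of_add_eq_zero_left h₁
  have hg₂ : bil q γ ν₂ = c₂ • g := by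
    rw [← neg_one_zsmul, hbil, bil_zsmul_left hbil, hc₂, neg_one_zsmul] at h₂
    exact add_neg_eq_zero.mp h₂
  have hpZ : Prime (p : ℤ) := Nat.prime_iff_prime_int.mp hp
  rw [hg₁, Ne, hz, dvd_neg] at hγ₁
  rw [hg₂, Ne, hz] at hγ₂
  obtain ⟨j, hj⟩ := hp.odd_of_ne_two hodd
  have hj' : (p : ℤ) = 2 * j + 1 := by exact_mod_cast hj
  refine ⟨c₂ • ν₁ + c₁ • ν₂ + (j * m) • μ, ?_, ?_, ?_, ?_⟩
  · simp only [nsmul_add, smul_comm p, hμ, hν₁, hν₂, smul_zero, add_zero]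
  · simp only [map_add_eq_add_bil, hquad, qμ, qν₁, qν₂, hbil, bil_zsmul_left hbil,
      bil_zsmul_right hbil, bil_comm q _ μ, hc₁, hc₂, hm, smul_zero, zero_add, add_zero,
      smul_smul, ← add_smul]
    rw [hz, hj']
    exact ⟨c₁ * c₂ * m, by ring⟩
  · simp only [bil_add_right hbil, bil_zsmul_right hbil, hγμ, hg₁, hg₂, smul_zero, add_zero,
      smul_smul, ← add_smul]
    rw [hz]
    exact ⟨0, by ring⟩
  · simp only [bil_add_right hbil, bil_zsmul_right hbil, hμμ, hc₁, hc₂, smul_zero, add_zero,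
      smul_smul, ← add_smul]
    rw [Ne, hz, show c₂ * c₁ + c₁ * c₂ = 2 * (c₁ * c₂) by ring, hpZ.dvd_mul, hpZ.dvd_mul]
    have h2 : ¬ (p : ℤ) ∣ 2 := fun h =>
      hodd ((Nat.prime_dvd_prime_iff_eq hp Nat.prime_two).mp (by exact_mod_cast h))
    tauto

theorem bil_eq_zero_of_sub_mem (hbil : ∀ x y z : D, bil q (x + y) z = bil q x z + bil q y z)
    {H : AddSubgroup D} (hH : ∀ x ∈ H, q x = 0) {γ δ ν : D}
    (hγ : ∀ μ ∈ H, bil q γ μ = 0) (hδ : δ - γ ∈ H) (hν : ν ∈ H) : bil q δ ν = 0 := by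
  rw [← sub_add_cancel δ γ, hbil, hγ ν hν, bil, hH _ hδ, hH _ hν, hH _ (H.add_mem hδ hν)]
  simp

theorem eq_zero_of_mem_zmultiples_of_bil
    (hbil : ∀ x y z : D, bil q (x + y) z = bil q x z + bil q y z) {x y z : D}
    (hy : bil q x y = 0) (hz : z ∈ AddSubgroup.zmultiples y) : bil q x z = 0 := by
  obtain ⟨n, rfl⟩ := AddSubgroup.mem_zmultiples_iff.mp hz
  rw [bil_zsmul_right hbil, hy, smul_zero]

theorem eq_zero_of_mem_zmultiples_of_map
    (hquad : ∀ (n : ℤ) (x : D), q (n • x) = (n ^ 2 : ℤ) • q x) {y z : D}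
    (hy : q y = 0) (hz : z ∈ AddSubgroup.zmultiples y) : q z = 0 := by
  obtain ⟨n, rfl⟩ := AddSubgroup.mem_zmultiples_iff.mp hz
  rw [hquad, hy, smul_zero]

end

/-- Let `D` be a discriminant form of exponent a power of an odd prime `p`, and
`γ ∈ D`.  If `e^γ` lies in `im(↑)`, then `γ^⊥` contains at least two distinct
isotropic subgroups of order `p`. -/
theorem two_isotropic_of_basisVec_mem_imUp
    {D : Type*} [AddCommGroup D] [Fintype D] (p : ℕ) (hp : p.Prime) (hodd : p ≠ 2)
    (q : D → AddCircle (1 : ℚ))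
    (hquad : ∀ (n : ℤ) (x : D), q (n • x) = (n ^ 2 : ℤ) • q x)
    (hbil : ∀ x y z : D, bil q (x + y) z = bil q x z + bil q y z)
    (hnd : ∀ x : D, (∀ y : D, bil q x y = 0) → x = 0)
    (hexp : ∃ k : ℕ, ∀ x : D, p ^ k • x = 0)
    (γ : D) (h : eV γ ∈ imUp q) :
    ∃ H₁ H₂ : AddSubgroup D, H₁ ≠ H₂ ∧
      Nat.card H₁ = p ∧ Nat.card H₂ = p ∧
      (∀ x ∈ H₁, q x = 0) ∧ (∀ x ∈ H₂, q x = 0) ∧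
      (∀ x ∈ H₁, bil q γ x = 0) ∧ (∀ x ∈ H₂, bil q γ x = 0) := by
  by_contra hcon
  have huniq : ∀ ν₁ ν₂ : D, ν₁ ≠ 0 → ν₂ ≠ 0 → p • ν₁ = 0 → p • ν₂ = 0 → q ν₁ = 0 → q ν₂ = 0 →
      bil q γ ν₁ = 0 → bil q γ ν₂ = 0 →
      AddSubgroup.zmultiples ν₁ = AddSubgroup.zmultiples ν₂ := by
    intro ν₁ ν₂ n₁ n₂ t₁ t₂ q₁ q₂ b₁ b₂
    by_contra hne
    have := Fact.mk hp
    exact hcon ⟨_, _, hne, by rw [Nat.card_zmultiples, addOrderOf_eq_prime t₁ n₁],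
      by rw [Nat.card_zmultiples, addOrderOf_eq_prime t₂ n₂],
      fun x => eq_zero_of_mem_zmultiples_of_map hquad q₁,
      fun x => eq_zero_of_mem_zmultiples_of_map hquad q₂,
      fun x => eq_zero_of_mem_zmultiples_of_bil hbil b₁,
      fun x => eq_zero_of_mem_zmultiples_of_bil hbil b₂⟩
  obtain ⟨μ, hμ0, hμ, qμ, hγμ⟩ :
      ∃ μ : D, μ ≠ 0 ∧ p • μ = 0 ∧ q μ = 0 ∧ bil q γ μ = 0 := by
    by_contra! hnone
    have hle : imUp q ≤ LinearMap.ker (LinearMap.proj γ : (D → ℂ) →ₗ[ℂ] ℂ) := by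
      refine Submodule.span_le.mpr ?_
      rintro _ ⟨H, hH, hiso, γ', hγ', rfl⟩
      refine if_neg fun hmem => ?_
      obtain ⟨ν, hνH, hν0, hν⟩ := exists_ne_zero_nsmul_prime_eq_zero hexp hH
      exact hnone ν hν0 hν (hiso ν hνH) (bil_eq_zero_of_sub_mem hbil hiso hγ' hmem hνH)
    simpa [eV] using hle h
  obtain ⟨τ, hτ0, hτ, hgood⟩ : ∃ τ : D, τ ≠ 0 ∧ τ ∈ AddSubgroup.zmultiples μ ∧
      ∀ ν : D, p • ν = 0 → q ν = 0 → bil q (γ + τ) ν = 0 → bil q γ ν = 0 := by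
    by_contra! hbad
    obtain ⟨ν₁, hν₁, qν₁, h₁, hγ₁⟩ := hbad μ hμ0 (AddSubgroup.mem_zmultiples μ)
    obtain ⟨ν₂, hν₂, qν₂, h₂, hγ₂⟩ := hbad (-μ) (neg_ne_zero.mpr hμ0)
      (neg_mem (AddSubgroup.mem_zmultiples μ))
    obtain ⟨x, hx, qx, hγx, hμx⟩ := exists_isotropic_not_orthogonal hbil hquad hp hodd
      hμ hν₁ hν₂ qμ qν₁ qν₂ hγμ h₁ h₂ hγ₁ hγ₂
    have hx0 : x ≠ 0 := by
      rintro rfl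
      exact hμx (by simpa using bil_zsmul_right hbil 0 μ 0)
    have hxμ : x ∈ AddSubgroup.zmultiples μ :=
      huniq x μ hx0 hμ0 hx hμ qx qμ hγx hγμ ▸ AddSubgroup.mem_zmultiples x
    refine hμx (eq_zero_of_mem_zmultiples_of_bil hbil ?_ hxμ)
    simpa [qμ, two_zsmul, map_add_eq_add_bil] using hquad 2 μ
  have hle : imUp q ≤ LinearMap.ker
      ((LinearMap.proj γ : (D → ℂ) →ₗ[ℂ] ℂ) - LinearMap.proj (γ + τ)) := by
    refine Submodule.span_le.mpr ?_
    rintro _ ⟨H, hH, hiso, γ', hγ', rfl⟩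
    obtain ⟨ν, hνH, hν0, hν⟩ := exists_ne_zero_nsmul_prime_eq_zero hexp hH
    have hτH : bil q γ ν = 0 → τ ∈ H := fun hγν => by
      rw [huniq μ ν hμ0 hν0 hμ hν qμ (hiso ν hνH) hγμ hγν] at hτ
      exact AddSubgroup.zmultiples_le_of_mem hνH hτ
    have hiff : γ - γ' ∈ H ↔ γ + τ - γ' ∈ H := by
      rw [add_sub_right_comm]
      refine ⟨fun hmem => H.add_mem hmem ?_, fun hmem => (H.add_mem_cancel_right ?_).mp hmem⟩
      · exact hτH (bil_eq_zero_of_sub_mem hbil hiso hγ' hmem hνH)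
      · rw [← add_sub_right_comm] at hmem
        exact hτH (hgood ν hν (hiso ν hνH) (bil_eq_zero_of_sub_mem hbil hiso hγ' hmem hνH))
    simp [liftVec, hiff]
  simpa [eV, hτ0] using hle h
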